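/- arXiv:1010.3671 — 2 statements merged into one kernel-verified Lean document; each statement's English description precedes it below -/
import Mathlib

section
/- Let k be a commutative ring and A a commutative k-algebra equipped with a k-bilinear map π : A × A → A that is antisymmetric, a derivation in each argument (π(a,bc) = b·π(a,c) + c·π(a,b)), and satisfies the Jacobi identity π(π(a,b),c) + π(π(b,c),a) + π(π(c,a),b) = 0. Let I be an ideal of A with π(x,y) ∈ I for all x,y ∈ I. Then there is a unique k-bilinear bracket [ , ] on I/I² such that [x mod I², y mod I²] = π(x,y) mod I² for all x,y ∈ I, and this bracket is antisymmetric and satisfies the Jacobi identity, making I/I² a Lie algebra over k. -/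
/-- For a Poisson bracket π on A and a coisotropic ideal I (π(I,I) ⊆ I),
the bracket descends to a unique k-bilinear bracket on the conormal module I/I², which
is antisymmetric and satisfies the Jacobi identity, making I/I² a Lie algebra over k. -/
theorem conormal_module_lie_bracket
    (k : Type*) [CommRing k] (A : Type*) [CommRing A] [Algebra k A]
    (π : A →ₗ[k] A →ₗ[k] A)
    (hanti : ∀ a b : A, π a b = - π b a)
    (hleibniz : ∀ a b c : A, π a (b * c) = b * π a c + c * π a b)
    (hjacobi : ∀ a b c : A, π (π a b) c + π (π b c) a + π (π c a) b = 0)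
    (I : Ideal A)
    (hcoiso : ∀ x ∈ I, ∀ y ∈ I, π x y ∈ I) :
    (∃! br : I.Cotangent →ₗ[k] I.Cotangent →ₗ[k] I.Cotangent,
      ∀ x y : I, br (I.toCotangent x) (I.toCotangent y)
        = I.toCotangent ⟨π x.1 y.1, hcoiso x.1 x.2 y.1 y.2⟩) ∧
    (∀ br : I.Cotangent →ₗ[k] I.Cotangent →ₗ[k] I.Cotangent,
      (∀ x y : I, br (I.toCotangent x) (I.toCotangent y)
        = I.toCotangent ⟨π x.1 y.1, hcoiso x.1 x.2 y.1 y.2⟩) →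
      (∀ u v : I.Cotangent, br u v = - br v u) ∧
      (∀ u v w : I.Cotangent, br (br u v) w + br (br v w) u + br (br w u) v = 0)) := by
  -- bracketing with an element of I preserves I ^ 2
  have key : ∀ x ∈ I, ∀ z ∈ I ^ 2, π x z ∈ I ^ 2 := by
    intro x hx z hz
    rw [pow_two] at hz ⊢
    induction hz using Submodule.mul_induction_on' with
    | mem_mul_mem b hb c hc =>
      rw [hleibniz]
      exact add_mem (Ideal.mul_mem_mul hb (hcoiso x hx c hc))
        (Ideal.mul_mem_mul hc (hcoiso x hx b hb))
    | add a _ b _ ha hb => rw [map_add]; exact add_mem ha hb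
  have wd : ∀ x y x' y' : I, I.toCotangent x = I.toCotangent x' →
      I.toCotangent y = I.toCotangent y' →
      I.toCotangent ⟨π x.1 y.1, hcoiso x.1 x.2 y.1 y.2⟩
        = I.toCotangent ⟨π x'.1 y'.1, hcoiso x'.1 x'.2 y'.1 y'.2⟩ := by
    intro x y x' y' hx hy
    rw [Ideal.toCotangent_eq] at hx hy ⊢
    have h1 := key x.1 x.2 _ hy
    have h2 := key y'.1 y'.2 _ hx
    have h3 : π x.1 y.1 - π x'.1 y'.1 = π x.1 (y.1 - y'.1) - π y'.1 (x.1 - x'.1) := by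
      rw [map_sub, map_sub, hanti y'.1 x.1, hanti y'.1 x'.1]
      ring
    change π x.1 y.1 - π x'.1 y'.1 ∈ I ^ 2
    rw [h3]
    exact sub_mem h1 h2
  have hsurj := I.toCotangent_surjective
  have hsmul : ∀ (c : k) (x : I), I.toCotangent (c • x) = c • I.toCotangent x :=
    fun c x => LinearMap.map_smul_of_tower _ c x
  obtain ⟨s, hs⟩ := hsurj.hasRightInverse
  let f : I.Cotangent → I.Cotangent → I.Cotangent := fun u v =>
    I.toCotangent ⟨π (s u).1 (s v).1, hcoiso _ (s u).2 _ (s v).2⟩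
  have hf : ∀ x y : I, f (I.toCotangent x) (I.toCotangent y)
      = I.toCotangent ⟨π x.1 y.1, hcoiso x.1 x.2 y.1 y.2⟩ :=
    fun x y => wd _ _ _ _ (hs _) (hs _)
  refine ⟨⟨LinearMap.mk₂ k f ?_ ?_ ?_ ?_, hf, ?_⟩, ?_⟩
  · intro u v w
    obtain ⟨x, rfl⟩ := hsurj u
    obtain ⟨y, rfl⟩ := hsurj v
    obtain ⟨z, rfl⟩ := hsurj w
    rw [← map_add, hf, hf, hf, ← map_add]
    congr 1
    ext
    simp
  · intro c u v
    obtain ⟨x, rfl⟩ := hsurj u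
    obtain ⟨y, rfl⟩ := hsurj v
    rw [← hsmul, hf, hf, ← hsmul]
    congr 1
    ext
    simp
  · intro u v w
    obtain ⟨x, rfl⟩ := hsurj u
    obtain ⟨y, rfl⟩ := hsurj v
    obtain ⟨z, rfl⟩ := hsurj w
    rw [← map_add, hf, hf, hf, ← map_add]
    congr 1
    ext
    simp
  · intro c u v
    obtain ⟨x, rfl⟩ := hsurj u
    obtain ⟨y, rfl⟩ := hsurj v
    rw [← hsmul, hf, hf, ← hsmul]
    congr 1
    ext
    simp
  · intro br hbr
    refine LinearMap.ext fun u => LinearMap.ext fun v => ?_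
    obtain ⟨x, rfl⟩ := hsurj u
    obtain ⟨y, rfl⟩ := hsurj v
    rw [hbr, LinearMap.mk₂_apply, hf]
  · intro br hbr
    constructor
    · intro u v
      obtain ⟨x, rfl⟩ := hsurj u
      obtain ⟨y, rfl⟩ := hsurj v
      rw [hbr, hbr, ← map_neg]
      congr 1
      ext
      exact hanti _ _
    · intro u v w
      obtain ⟨x, rfl⟩ := hsurj u
      obtain ⟨y, rfl⟩ := hsurj v
      obtain ⟨z, rfl⟩ := hsurj w
      simp only [hbr]
      rw [← map_add, ← map_add, ← map_zero I.toCotangent]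
      congr 1
      ext
      exact hjacobi _ _ _
end

section
/- Let k be a commutative ring, A a commutative k-algebra with a Poisson bracket π (antisymmetric, a derivation in each argument, satisfying the Jacobi identity π(π(a,b),c) + π(π(b,c),a) + π(π(c,a),b) = 0), I an ideal with π(I,I) ⊆ I, and E an A-module with I·E = 0. Let ∇ : I → End_k(E) be an additive map satisfying ∇(a·x)(e) = a·∇(x)(e) and ∇(x)(a·e) = a·∇(x)(e) + π(x,a)·e for all a ∈ A, x ∈ I, e ∈ E. Define the curvature c(x,y) := ∇(x)∘∇(y) − ∇(y)∘∇(x) − ∇(π(x,y)). Then for all a ∈ A, x,y ∈ I, e ∈ E: c(ax,y)(e) = a·c(x,y)(e), c(x,ay)(e) = a·c(x,y)(e), c(x,y)(a·e) = a·c(x,y)(e), c(x,y) = −c(y,x), and c(x,y) = 0 whenever x ∈ I². -/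
/-- For a coisotropic ideal I in a Poisson algebra (A, π) and a
(0,1)-connection D on a B = A/I-module E (I·E = 0), the curvature
c(x,y) = [D(x),D(y)] − D(π(x,y)) is A-bilinear and alternating in x,y ∈ I, takes values
in A-linear (hence B-linear) endomorphisms, and vanishes whenever x ∈ I². -/
theorem curvature_of_null_foliation_connection
    (k : Type*) [CommRing k] (A : Type*) [CommRing A] [Algebra k A]
    (π : A →ₗ[k] A →ₗ[k] A)
    (hanti : ∀ a b : A, π a b = - π b a)
    (hleibniz : ∀ a b c : A, π a (b * c) = b * π a c + c * π a b)
    (hjacobi : ∀ a b c : A, π (π a b) c + π (π b c) a + π (π c a) b = 0)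
    (I : Ideal A)
    (hcoiso : ∀ x ∈ I, ∀ y ∈ I, π x y ∈ I)
    (E : Type*) [AddCommGroup E] [Module A E]
    [Module k E] [IsScalarTower k A E]
    (hIE : ∀ x ∈ I, ∀ e : E, x • e = 0)
    (D : I →+ (E →ₗ[k] E))
    (h1 : ∀ (a : A) (x : I) (e : E), D (a • x) e = a • D x e)
    (h2 : ∀ (a : A) (x : I) (e : E), D x (a • e) = a • D x e + π x.1 a • e) :
    ∀ (a : A) (x y : I) (e : E),
      (let c : I → I → (E →ₗ[k] E) := fun x y =>
        D x ∘ₗ D y - D y ∘ₗ D x - D ⟨π x.1 y.1, hcoiso x.1 x.2 y.1 y.2⟩;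
      c (a • x) y e = a • c x y e ∧
      c x (a • y) e = a • c x y e ∧
      c x y (a • e) = a • c x y e ∧
      c x y = - c y x ∧
      ((x : A) ∈ I ^ 2 → c x y = 0)) := by
  have E1 : ∀ (a : A) (x y : I) (h : π (a • x).1 y.1 ∈ I) (e : E),
      D ⟨π (a • x).1 y.1, h⟩ e
        = a • D ⟨π x.1 y.1, hcoiso x.1 x.2 y.1 y.2⟩ e + π a y.1 • D x e := by
    intro a x y h e
    have hx : (⟨π (a • x).1 y.1, h⟩ : I)
        = a • (⟨π x.1 y.1, hcoiso x.1 x.2 y.1 y.2⟩ : I) + π a y.1 • x := by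
      apply Subtype.ext
      simp only [Submodule.coe_add, Submodule.coe_smul, smul_eq_mul]
      rw [hanti, hleibniz, hanti x.1 y.1, hanti a y.1]
      ring
    rw [hx, map_add, LinearMap.add_apply, h1, h1]
  let c : I → I → (E →ₗ[k] E) := fun x y =>
    D x ∘ₗ D y - D y ∘ₗ D x - D ⟨π x.1 y.1, hcoiso x.1 x.2 y.1 y.2⟩
  have hc : ∀ x y e, c x y e
      = D x (D y e) - D y (D x e) - D ⟨π x.1 y.1, hcoiso x.1 x.2 y.1 y.2⟩ e :=
    fun x y e => rfl
  have C1 : ∀ (a : A) (x y : I) (e : E), c (a • x) y e = a • c x y e := by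
    intro a x y e
    rw [hc, hc, E1, h1, h1, h2, hanti a y.1]
    module
  have C4 : ∀ x y, c x y = - c y x := by
    intro x y
    ext e
    have hx : (⟨π x.1 y.1, hcoiso x.1 x.2 y.1 y.2⟩ : I)
        = - ⟨π y.1 x.1, hcoiso y.1 y.2 x.1 x.2⟩ := Subtype.ext (hanti _ _)
    rw [LinearMap.neg_apply, hc, hc, hx, map_neg, LinearMap.neg_apply]
    abel
  have C2 : ∀ (a : A) (x y : I) (e : E), c x (a • y) e = a • c x y e := by
    intro a x y e
    rw [C4 x (a • y), C4 x y, LinearMap.neg_apply, C1, LinearMap.neg_apply, smul_neg]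
  have C3 : ∀ (a : A) (x y : I) (e : E), c x y (a • e) = a • c x y e := by
    intro a x y e
    have hj : π (π x.1 y.1) a = π x.1 (π y.1 a) - π y.1 (π x.1 a) := by
      have h := hjacobi x.1 y.1 a
      rw [hanti (π y.1 a) x.1, hanti a x.1, map_neg, LinearMap.neg_apply,
        hanti (π x.1 a) y.1] at h
      linear_combination h
    rw [hc, hc]
    simp only [h2, map_add]
    rw [hj]
    module
  have Cadd : ∀ x x' y, c (x + x') y = c x y + c x' y := by
    intro x x' y
    ext e
    have hx : (⟨π (x + x').1 y.1, hcoiso _ (x + x').2 y.1 y.2⟩ : I)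
        = ⟨π x.1 y.1, hcoiso x.1 x.2 y.1 y.2⟩
          + ⟨π x'.1 y.1, hcoiso x'.1 x'.2 y.1 y.2⟩ := by
      apply Subtype.ext
      simp
    rw [LinearMap.add_apply, hc, hc, hc, hx]
    simp only [map_add, LinearMap.add_apply]
    abel
  have C5 : ∀ y : I, ∀ z ∈ I * I, ∃ hz : z ∈ I, c ⟨z, hz⟩ y = 0 := by
    intro y z hz
    induction hz using Submodule.mul_induction_on' with
    | mem_mul_mem m hm n hn =>
      refine ⟨I.mul_mem_left m hn, ?_⟩
      ext e
      exact (C1 m ⟨n, hn⟩ y e).trans (hIE m hm _)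
    | add u hu v hv ihu ihv =>
      obtain ⟨hu', h3⟩ := ihu
      obtain ⟨hv', h4⟩ := ihv
      refine ⟨I.add_mem hu' hv', ?_⟩
      have h5 := Cadd ⟨u, hu'⟩ ⟨v, hv'⟩ y
      rw [h3, h4, add_zero] at h5
      exact h5
  intro a x y e
  refine ⟨C1 a x y e, C2 a x y e, C3 a x y e, C4 x y, fun hx => ?_⟩
  rw [pow_two] at hx
  obtain ⟨_, h⟩ := C5 y x.1 hx
  exact h
end
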